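/- arXiv:2004.14663 — 2 statements merged into one kernel-verified Lean document; each statement's English description precedes it below -/
import Mathlib

section
/- Let G = f(Ω, F̄, M̄) be an accessible set and suppose the graph associated with G is connected. Then for every nonempty subset M̃ ⊆ G, the accessible set generated from M̃ equals G, i.e., f(Ω, F̄, M̃) = G. -/
open Matrix Complex Kronecker
open scoped Classical

noncomputable section

/-- The state/operator space of an `N`-qubit system, indexed by bit strings. -/
abbrev Mat (N : ℕ) := Matrix (Fin N → Fin 2) (Fin N → Fin 2) ℂ

/-- The four Pauli matrices: σ₀ = I, σ₁ = X, σ₂ = Y, σ₃ = Z. -/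
def pauli (a : Fin 4) : Matrix (Fin 2) (Fin 2) ℂ :=
  if a = 0 then 1
  else if a = 1 then !![0, 1; 1, 0]
  else if a = 2 then !![0, -Complex.I; Complex.I, 0]
  else !![1, 0; 0, -1]

/-- The Pauli string σ_{s 1} ⊗ σ_{s 2} ⊗ ⋯ ⊗ σ_{s N}, realized entrywise. -/
def pauliString {N : ℕ} (s : Fin N → Fin 4) : Mat N :=
  fun i j => ∏ k, pauli (s k) (i k) (j k)

/-- Ω : the set of all Pauli strings on `N` qubits. -/
def Omega (N : ℕ) : Set (Mat N) := Set.range pauliString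

/-- The commutator [A,B] = AB − BA. -/
def mcomm {n : Type*} [Fintype n] (A B : Matrix n n ℂ) : Matrix n n ℂ := A * B - B * A

/-- ⌊A,B⌉ : the unique Pauli string which is a nonzero scalar multiple of [A,B];
it is 0 when no such Pauli string exists (in particular when [A,B] = 0). -/
def pbracket {N : ℕ} (A B : Mat N) : Mat N :=
  if h : ∃ s : Fin N → Fin 4, ∃ c : ℂ, c ≠ 0 ∧ mcomm A B = c • pauliString s
  then pauliString h.choose else 0

/-- The accessible set f(Ω, F, M) : the smallest set containing M and closed under
adding ⌊τ,ν⌉ for τ already accessible, ν ∈ F with [τ,ν] ≠ 0. -/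
inductive Accessible {N : ℕ} (F M : Set (Mat N)) : Mat N → Prop
  | base {O : Mat N} : O ∈ M → Accessible F M O
  | step {τ ν : Mat N} : Accessible F M τ → ν ∈ F → mcomm τ ν ≠ 0 →
      Accessible F M (pbracket τ ν)

/-- The accessible set, as a set. -/
def accSet {N : ℕ} (F M : Set (Mat N)) : Set (Mat N) := {O | Accessible F M O}

/-- Adjacency in the graph with vertex set S, relative to the Hamiltonian set F:
distinct vertices O_m, O_n are adjacent iff Tr(O_nᴴ [O_m, ν]) ≠ 0 for some ν ∈ F. -/
def Adj {N : ℕ} (F S : Set (Mat N)) (A B : Mat N) : Prop :=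
  A ∈ S ∧ B ∈ S ∧ A ≠ B ∧ ∃ ν ∈ F, (Bᴴ * mcomm A ν).trace ≠ 0

/-- Connectivity of the graph on vertex set S: any two vertices are joined by a path. -/
def GraphConnected {N : ℕ} (F S : Set (Mat N)) : Prop :=
  ∀ A ∈ S, ∀ B ∈ S, Relation.ReflTransGen (Adj F S) A B

/-- Index string with value `a` at 0-indexed positions k and k+1, identity elsewhere. -/
def twoSite (N k : ℕ) (a : Fin 4) : Fin N → Fin 4 :=
  fun j => if (j : ℕ) = k ∨ (j : ℕ) = k + 1 then a else 0

/-- Chain Hamiltonian set F̄_K = {X_jX_{j+1}, Y_jY_{j+1} : 1 ≤ j ≤ K−1 } (1-indexed),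
i.e., couplings on 0-indexed positions (t, t+1) with t+1 < K. -/
def chainFk (N K : ℕ) : Set (Mat N) :=
  {O | ∃ t : ℕ, t + 1 < K ∧
    (O = pauliString (twoSite N t 1) ∨ O = pauliString (twoSite N t 2))}

/-- The full chain Hamiltonian set on N qubits. -/
def chainF (N : ℕ) : Set (Mat N) := chainFk N N

/-- Single-site Pauli string: `a` at 0-indexed position k, identity elsewhere. -/
def singleSite (N k : ℕ) (a : Fin 4) : Fin N → Fin 4 :=
  fun j => if (j : ℕ) = k then a else 0

/-- Z on 0-indexed positions 0,…,m−1, `a` at position m, identity elsewhere. -/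
def zTail (N m : ℕ) (a : Fin 4) : Fin N → Fin 4 :=
  fun j => if (j : ℕ) < m then 3 else if (j : ℕ) = m then a else 0

/-- A Pauli string is k-finite (k is 1-indexed) when its k-th factor is not the
identity and all factors beyond position k are the identity. -/
def kFinite {N : ℕ} (k : ℕ) (O : Mat N) : Prop :=
  ∃ s : Fin N → Fin 4, O = pauliString s ∧
    (∀ j : Fin N, (j : ℕ) + 1 = k → s j ≠ 0) ∧
    (∀ j : Fin N, k ≤ (j : ℕ) → s j = 0)

/-- Path along an edging sequence E: iteratively applying O ↦ ⌊O,ν⌉ along E has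
every intermediate commutator nonzero and ends at the indicated operator. -/
def IsPath {N : ℕ} : Mat N → List (Mat N) → Mat N → Prop
  | A, [], B => A = B
  | A, n :: E, B => mcomm A n ≠ 0 ∧ IsPath (pbracket A n) E B

/-- G_{⌊k} : equal to G_1 when k = 1 and to G_k \ G_{k−1} when k > 1. -/
def Gfloor {N : ℕ} (M : Set (Mat N)) (k : ℕ) : Set (Mat N) :=
  if k = 1 then accSet (chainFk N 1) M
  else accSet (chainFk N k) M \ accSet (chainFk N (k - 1)) M

/-- G¹_{⌊k+1} : the operators in G_{⌊k+1} adjacent, in the graph of G_{k+1},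
to some element of G_k. -/
def G1floor {N : ℕ} (M : Set (Mat N)) (k : ℕ) : Set (Mat N) :=
  {O | O ∈ Gfloor M (k + 1) ∧
    ∃ P ∈ accSet (chainFk N k) M,
      Adj (chainFk N (k + 1)) (accSet (chainFk N (k + 1)) M) P O}

/-- The Kronecker product of a family of `2 × 2` matrices, realized entrywise. -/
def siteProd {N : ℕ} (f : Fin N → Matrix (Fin 2) (Fin 2) ℂ) : Mat N :=
  fun i j => ∏ k, f k (i k) (j k)

theorem siteProd_mul {N : ℕ} (f g : Fin N → Matrix (Fin 2) (Fin 2) ℂ) :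
    siteProd f * siteProd g = siteProd fun k => f k * g k := by
  ext i j
  simp only [siteProd, Matrix.mul_apply, ← Finset.prod_mul_distrib]
  rw [Finset.prod_univ_sum, Fintype.piFinset_univ]

theorem trace_siteProd {N : ℕ} (f : Fin N → Matrix (Fin 2) (Fin 2) ℂ) :
    (siteProd f).trace = ∏ k, (f k).trace := by
  simp only [siteProd, Matrix.trace, Matrix.diag]
  rw [Finset.prod_univ_sum, Fintype.piFinset_univ]

theorem conjTranspose_siteProd {N : ℕ} (f : Fin N → Matrix (Fin 2) (Fin 2) ℂ) :
    (siteProd f)ᴴ = siteProd fun k => (f k)ᴴ := by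
  ext i j
  simp [siteProd, Matrix.conjTranspose_apply]

theorem siteProd_smul {N : ℕ} (c : Fin N → ℂ) (f : Fin N → Matrix (Fin 2) (Fin 2) ℂ) :
    (siteProd fun k => c k • f k) = (∏ k, c k) • siteProd f := by
  ext i j
  simp [siteProd, Finset.prod_mul_distrib]

theorem pauliString_eq_siteProd {N : ℕ} (s : Fin N → Fin 4) :
    pauliString s = siteProd fun k => pauli (s k) := rfl

theorem exists_pauli_mul_eq_smul (a b : Fin 4) :
    ∃ c : ℂ, pauli a * pauli b = c • pauli (a ^^^ b) := by
  fin_cases a <;> fin_cases b <;>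
    first
    | (refine ⟨1, ?_⟩
       ext i j
       fin_cases i <;> fin_cases j <;> simp [pauli, Matrix.mul_apply]
       done)
    | (refine ⟨Complex.I, ?_⟩
       ext i j
       fin_cases i <;> fin_cases j <;> simp [pauli, Matrix.mul_apply]
       done)
    | (refine ⟨-Complex.I, ?_⟩
       ext i j
       fin_cases i <;> fin_cases j <;> simp [pauli, Matrix.mul_apply])

theorem trace_conjTranspose_pauli_mul_pauli_of_ne {a b : Fin 4} (h : a ≠ b) :
    ((pauli a)ᴴ * pauli b).trace = 0 := by
  fin_cases a <;> fin_cases b <;>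
    simp_all [pauli, Matrix.trace, Matrix.mul_apply]

theorem exists_pauliString_mul_eq_smul {N : ℕ} (s t : Fin N → Fin 4) :
    ∃ c : ℂ, pauliString s * pauliString t = c • pauliString fun k => s k ^^^ t k := by
  choose c hc using exists_pauli_mul_eq_smul
  refine ⟨∏ k, c (s k) (t k), ?_⟩
  simp only [pauliString_eq_siteProd, siteProd_mul, hc, siteProd_smul]

theorem exists_mcomm_pauliString_eq_smul {N : ℕ} (s t : Fin N → Fin 4) :
    ∃ (u : Fin N → Fin 4) (c : ℂ),
      mcomm (pauliString s) (pauliString t) = c • pauliString u := by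
  obtain ⟨c, hc⟩ := exists_pauliString_mul_eq_smul s t
  obtain ⟨d, hd⟩ := exists_pauliString_mul_eq_smul t s
  refine ⟨fun k => s k ^^^ t k, c - d, ?_⟩
  have hcomm : (fun k => t k ^^^ s k) = fun k => s k ^^^ t k := by
    have key : ∀ a b : Fin 4, a ^^^ b = b ^^^ a := by decide
    exact funext fun k => key _ _
  rw [mcomm, hc, hd, hcomm, sub_smul]

theorem eq_of_trace_conjTranspose_pauliString_mul_ne_zero {N : ℕ} {s t : Fin N → Fin 4}
    (h : ((pauliString s)ᴴ * pauliString t).trace ≠ 0) : s = t := by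
  rw [pauliString_eq_siteProd, pauliString_eq_siteProd, conjTranspose_siteProd, siteProd_mul,
    trace_siteProd, Finset.prod_ne_zero_iff] at h
  funext k
  by_contra hk
  exact h k (Finset.mem_univ k) (trace_conjTranspose_pauli_mul_pauli_of_ne hk)

theorem pbracket_spec {N : ℕ} {A B : Mat N} (hA : A ∈ Omega N) (hB : B ∈ Omega N)
    (h : mcomm A B ≠ 0) :
    ∃ (u : Fin N → Fin 4) (c : ℂ), mcomm A B = c • pauliString u ∧
      pbracket A B = pauliString u := by
  obtain ⟨s, rfl⟩ := hA
  obtain ⟨t, rfl⟩ := hB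
  obtain ⟨u, c, hc⟩ := exists_mcomm_pauliString_eq_smul s t
  have hex : ∃ u : Fin N → Fin 4, ∃ c : ℂ, c ≠ 0 ∧
      mcomm (pauliString s) (pauliString t) = c • pauliString u := by
    refine ⟨u, c, ?_, hc⟩
    rintro rfl
    exact h (by rw [hc, zero_smul])
  obtain ⟨d, -, hd⟩ := hex.choose_spec
  exact ⟨hex.choose, d, hd, dif_pos hex⟩

theorem accSet_subset_Omega {N : ℕ} {F M : Set (Mat N)} (hF : F ⊆ Omega N)
    (hM : M ⊆ Omega N) : accSet F M ⊆ Omega N := by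
  intro O hO
  induction hO with
  | base h => exact hM h
  | step _ hν hne ih =>
    obtain ⟨u, -, -, hu⟩ := pbracket_spec ih (hF hν) hne
    exact ⟨u, hu.symm⟩

theorem accSet_subset_of_subset_accSet {N : ℕ} {F M M' : Set (Mat N)}
    (h : M' ⊆ accSet F M) : accSet F M' ⊆ accSet F M := by
  intro O hO
  induction hO with
  | base hO => exact h hO
  | step _ hν hne ih => exact Accessible.step ih hν hne

theorem eq_pbracket_of_trace_ne_zero {N : ℕ} {A B ν : Mat N} (hA : A ∈ Omega N)
    (hB : B ∈ Omega N) (hν : ν ∈ Omega N) (h : (Bᴴ * mcomm A ν).trace ≠ 0) :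
    B = pbracket A ν := by
  have hne : mcomm A ν ≠ 0 := by
    intro h0
    simp [h0] at h
  obtain ⟨u, c, hc, hu⟩ := pbracket_spec hA hν hne
  obtain ⟨s, rfl⟩ := hB
  rw [hc, Matrix.mul_smul, Matrix.trace_smul] at h
  rw [hu, eq_of_trace_conjTranspose_pauliString_mul_ne_zero (right_ne_zero_of_smul h)]

theorem stmt_7 {N : ℕ} (F M : Set (Mat N)) (hF : F ⊆ Omega N) (hM : M ⊆ Omega N)
    (hconn : GraphConnected F (accSet F M)) :
    ∀ Mt : Set (Mat N), Mt.Nonempty → Mt ⊆ accSet F M →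
      accSet F Mt = accSet F M := by
  rintro Mt ⟨A, hA⟩ hMt
  have hΩ := accSet_subset_Omega hF hM
  refine (accSet_subset_of_subset_accSet hMt).antisymm fun B hB => ?_
  induction hconn A (hMt hA) B hB with
  | refl => exact Accessible.base hA
  | @tail P Q _ hadj ih =>
    obtain ⟨hP, hQ, -, ν, hν, htr⟩ := hadj
    rw [eq_pbracket_of_trace_ne_zero (hΩ hP) (hΩ hQ) (hF hν) htr]
    refine Accessible.step (ih hP) hν fun h0 => htr ?_
    rw [h0, Matrix.mul_zero, Matrix.trace_zero]
end
end

section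
/- Let F̄ = { X_k X_{k+1}, Y_k Y_{k+1} : 1 ≤ k ≤ N−1 } be the chain Hamiltonian set on N qubits. Let O₁ ∈ Ω, let ν₁, …, ν_m ∈ F̄, and let E₁ = (ν_{ε(1)}, …, ν_{ε(m)}) and E₂ = (ν_{ε'(1)}, …, ν_{ε'(m)}) be two orderings of these operators, where ε and ε' are permutations of {1,…,m}. Suppose that iteratively applying O ↦ ⌊O, ν⌉ to O₁ along the sequence E₁ has every intermediate commutator nonzero and ends at O₂ ∈ Ω, and likewise along E₂ ends at O₃ ∈ Ω. Then O₂ = O₃: the endpoint of a path is independent of the ordering of its edging sequence. -/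
open Matrix Complex Kronecker
open scoped Classical

noncomputable section

/-- Single-site Pauli matrices multiply like bitwise exclusive or on labels, up to a nonzero phase. -/
lemma exists_pauli_mul (a b : Fin 4) :
    ∃ c : ℂ, c ≠ 0 ∧ pauli a * pauli b = c • pauli (a ^^^ b) := by
  suffices h : pauli a * pauli b = pauli (a ^^^ b) ∨
      pauli a * pauli b = Complex.I • pauli (a ^^^ b) ∨
      pauli a * pauli b = (-Complex.I) • pauli (a ^^^ b) by
    obtain h | h | h := h
    · exact ⟨1, one_ne_zero, by rw [h, one_smul]⟩
    · exact ⟨Complex.I, Complex.I_ne_zero, h⟩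
    · exact ⟨-Complex.I, neg_ne_zero.2 Complex.I_ne_zero, h⟩
  fin_cases a <;> fin_cases b <;>
  first
  | left
    ext i j
    fin_cases i <;> fin_cases j <;> simp [pauli, Matrix.mul_apply, Fin.sum_univ_two] <;> done
  | right; left
    ext i j
    fin_cases i <;> fin_cases j <;> simp [pauli, Matrix.mul_apply, Fin.sum_univ_two] <;> done
  | right; right
    ext i j
    fin_cases i <;> fin_cases j <;> simp [pauli, Matrix.mul_apply, Fin.sum_univ_two]

lemma exists_pauli_apply_ne_zero (a : Fin 4) : ∃ i j, pauli a i j ≠ 0 := by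
  fin_cases a
  · exact ⟨0, 0, by simp [pauli]⟩
  · exact ⟨0, 1, by simp [pauli]⟩
  · exact ⟨0, 1, by simp [pauli]⟩
  · exact ⟨0, 0, by simp [pauli]⟩

/-- Proportional Pauli matrices coincide. -/
lemma eq_of_smul_pauli_eq {a b : Fin 4} {c d : ℂ} (hc : c ≠ 0)
    (h : c • pauli a = d • pauli b) : a = b := by
  have h00 := congrFun (congrFun h 0) 0
  have h01 := congrFun (congrFun h 0) 1
  have h10 := congrFun (congrFun h 1) 0
  have h11 := congrFun (congrFun h 1) 1
  fin_cases a <;> fin_cases b <;> simp [pauli, hc] at h00 h01 h10 h11 ⊢ <;>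
    grind [Complex.I_ne_zero]

/-- Pauli strings multiply like sitewise exclusive or on labels, up to a nonzero phase. -/
lemma exists_pauliString_mul {N : ℕ} (s t : Fin N → Fin 4) :
    ∃ c : ℂ, c ≠ 0 ∧
      pauliString s * pauliString t = c • pauliString (fun k => s k ^^^ t k) := by
  choose f hf hmul using exists_pauli_mul
  refine ⟨∏ k, f (s k) (t k), Finset.prod_ne_zero_iff.2 fun k _ => hf _ _, ?_⟩
  ext i j
  have hk : ∀ k, ∑ x, pauli (s k) (i k) x * pauli (t k) x (j k) =
      f (s k) (t k) * pauli (s k ^^^ t k) (i k) (j k) := fun k => by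
    simpa [Matrix.mul_apply] using congrFun (congrFun (hmul (s k) (t k)) (i k)) (j k)
  simp only [Matrix.mul_apply, Matrix.smul_apply, smul_eq_mul, pauliString,
    ← Finset.prod_mul_distrib, ← hk]
  exact (Fintype.prod_sum
    (fun (k : Fin N) (x : Fin 2) => pauli (s k) (i k) x * pauli (t k) x (j k))).symm

/-- Proportional Pauli strings have the same labels. -/
lemma eq_of_smul_pauliString_eq {N : ℕ} {s t : Fin N → Fin 4} {c d : ℂ} (hc : c ≠ 0)
    (h : c • pauliString s = d • pauliString t) : s = t := by
  funext k
  choose i j hij using fun k => exists_pauli_apply_ne_zero (s k)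
  have upd : ∀ (u : Fin N → Fin 4) (a b : Fin 2),
      pauliString u (Function.update i k a) (Function.update j k b) =
        pauli (u k) a b * ∏ l ∈ Finset.univ.erase k, pauli (u l) (i l) (j l) := by
    intro u a b
    rw [pauliString, ← Finset.mul_prod_erase _ _ (Finset.mem_univ k)]
    congr 1
    · simp
    · refine Finset.prod_congr rfl fun l hl => ?_
      simp [Finset.ne_of_mem_erase hl]
  have hentry : ∀ a b, c * (pauli (s k) a b *
        ∏ l ∈ Finset.univ.erase k, pauli (s l) (i l) (j l)) =
      d * (pauli (t k) a b * ∏ l ∈ Finset.univ.erase k, pauli (t l) (i l) (j l)) := by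
    intro a b
    rw [← upd, ← upd]
    exact congrFun (congrFun h _) _
  have hs : ∏ l ∈ Finset.univ.erase k, pauli (s l) (i l) (j l) ≠ 0 :=
    Finset.prod_ne_zero_iff.2 fun l _ => hij l
  refine eq_of_smul_pauli_eq (d := d * ∏ l ∈ Finset.univ.erase k, pauli (t l) (i l) (j l))
    (mul_ne_zero hc hs) ?_
  ext a b
  simp only [Matrix.smul_apply, smul_eq_mul]
  linear_combination hentry a b

/-- The bracket of noncommuting Pauli strings is the sitewise exclusive or of their labels. -/
lemma pbracket_pauliString {N : ℕ} (s t : Fin N → Fin 4)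
    (h : mcomm (pauliString s) (pauliString t) ≠ 0) :
    pbracket (pauliString s) (pauliString t) = pauliString (fun k => s k ^^^ t k) := by
  obtain ⟨c, -, hst⟩ := exists_pauliString_mul s t
  obtain ⟨d, -, hts⟩ := exists_pauliString_mul t s
  have hcomm : (fun k => t k ^^^ s k) = fun k => s k ^^^ t k :=
    funext fun k => (by decide : ∀ a b : Fin 4, a ^^^ b = b ^^^ a) _ _
  have hm : mcomm (pauliString s) (pauliString t) =
      (c - d) • pauliString (fun k => s k ^^^ t k) := by
    rw [mcomm, hst, hts, hcomm, sub_smul]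
  have hcd : c - d ≠ 0 := fun h0 => h (by rw [hm, h0, zero_smul])
  have hex : ∃ u : Fin N → Fin 4, ∃ c : ℂ, c ≠ 0 ∧
      mcomm (pauliString s) (pauliString t) = c • pauliString u := ⟨_, _, hcd, hm⟩
  rw [pbracket, dif_pos hex]
  obtain ⟨e, he, heq⟩ := hex.choose_spec
  rw [eq_of_smul_pauliString_eq he (heq.symm.trans hm)]

/-- The endpoint of a path of Pauli strings, in terms of labels. -/
lemma IsPath.eq_pauliString_foldl {N : ℕ} {g : Mat N → Fin N → Fin 4} {B : Mat N}
    {E : List (Mat N)} (hg : ∀ ν ∈ E, pauliString (g ν) = ν) {s : Fin N → Fin 4}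
    (h : IsPath (pauliString s) E B) :
    B = pauliString (E.foldl (fun u ν k => u k ^^^ g ν k) s) := by
  induction E generalizing s with
  | nil => exact h.symm
  | cons ν E ih =>
    obtain ⟨hne, hp⟩ := h
    have hν := hg ν List.mem_cons_self
    rw [← hν] at hne hp
    rw [pbracket_pauliString _ _ hne] at hp
    exact ih (fun μ hμ => hg μ (List.mem_cons_of_mem _ hμ)) hp

theorem stmt_14 {N : ℕ} (O₁ O₂ O₃ : Mat N) (h1 : O₁ ∈ Omega N)
    (h2 : O₂ ∈ Omega N) (h3 : O₃ ∈ Omega N)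
    (E₁ E₂ : List (Mat N)) (hE : ∀ ν ∈ E₁, ν ∈ chainF N) (hperm : E₁.Perm E₂)
    (hp1 : IsPath O₁ E₁ O₂) (hp2 : IsPath O₁ E₂ O₃) :
    O₂ = O₃ := by
  obtain ⟨s, rfl⟩ := h1
  have hg : ∀ ν ∈ E₁, pauliString (Function.invFun pauliString ν) = ν := by
    intro ν hν
    obtain ⟨t, -, h | h⟩ := hE ν hν
    · exact Function.invFun_eq ⟨_, h.symm⟩
    · exact Function.invFun_eq ⟨_, h.symm⟩
  rw [hp1.eq_pauliString_foldl hg,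
    hp2.eq_pauliString_foldl fun ν hν => hg ν (hperm.mem_iff.2 hν)]
  congr 1
  refine hperm.foldl_eq' (fun x _ y _ z => ?_) s
  funext k
  exact (by decide : ∀ a b c : Fin 4, a ^^^ b ^^^ c = a ^^^ c ^^^ b) _ _ _
end
end
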